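/- Let n ≥ 2 and let T = (T_{ij}) be a continuously differentiable n×n-matrix-valued function on Ω = {x ∈ ℝⁿ : |x| ≥ 1}. Then for every r > 1, ∫_{S_r} T_{ij,j} ν_i dH^{n−1} = ∫_{S_r} T_{ji,j} ν_i dH^{n−1}. -/

import Mathlib

open MeasureTheory
open scoped ENNReal

section HausdorffSphere

variable {E : Type*} [NormedAddCommGroup E] [InnerProductSpace ℝ E]

open Metric Module

/-- The closed hemisphere opposite to a unit vector `v` is contained in the image of a closed ball
of radius `2` under the inverse stereographic projection from `v`. -/
lemma hemisphere_subset_image_stereoInvFunAux {v : E} (hv : ‖v‖ = 1) :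
    {x : E | ‖x‖ = 1 ∧ inner ℝ v x ≤ 0} ⊆
      (fun w : (ℝ ∙ v)ᗮ ↦ stereoInvFunAux v (w : E)) '' closedBall 0 2 := by
  rintro x ⟨hx, hvx⟩
  have hne : x ≠ v := by
    rintro rfl
    rw [real_inner_self_eq_norm_sq, hx] at hvx
    norm_num at hvx
  refine ⟨stereoToFun v x, ?_,
    congrArg Subtype.val (stereo_left_inv hv (x := ⟨x, by simpa using hx⟩) hne)⟩
  rw [mem_closedBall_zero_iff, stereoToFun_apply, norm_smul, innerSL_apply_apply]
  have hc : ‖(2 : ℝ) / (1 - inner ℝ v x)‖ ≤ 2 := by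
    rw [Real.norm_of_nonneg (div_nonneg zero_le_two (by linarith))]
    exact div_le_self zero_le_two (by linarith)
  have hp : ‖(ℝ ∙ v)ᗮ.orthogonalProjectionOnto x‖ ≤ 1 :=
    hx ▸ (ℝ ∙ v)ᗮ.norm_orthogonalProjectionOnto_apply_le x
  nlinarith [norm_nonneg ((ℝ ∙ v)ᗮ.orthogonalProjectionOnto x)]

variable [MeasurableSpace E] [BorelSpace E]

lemma hausdorffMeasure_hemisphere_lt_top {m : ℕ} (hE : finrank ℝ E = m + 1) {v : E}
    (hv : ‖v‖ = 1) : μH[(m : ℝ)] {x : E | ‖x‖ = 1 ∧ inner ℝ v x ≤ 0} < ∞ := by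
  have : Fact (finrank ℝ E = m + 1) := ⟨hE⟩
  have : FiniteDimensional ℝ E := .of_fact_finrank_eq_succ m
  have hfr : finrank ℝ (ℝ ∙ v)ᗮ = m :=
    Submodule.finrank_orthogonal_span_singleton (by rintro rfl; simp at hv)
  have hK : IsCompact (closedBall (0 : (ℝ ∙ v)ᗮ) 2) := isCompact_closedBall 0 2
  have hsm : ContDiff ℝ 1 (fun w : (ℝ ∙ v)ᗮ ↦ stereoInvFunAux v (w : E)) :=
    contDiff_stereoInvFunAux.comp (ℝ ∙ v)ᗮ.subtypeL.contDiff
  obtain ⟨C, hC⟩ :=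
    hsm.locallyLipschitz.locallyLipschitzOn.exists_lipschitzOnWith_of_compact hK
  refine (measure_mono (hemisphere_subset_image_stereoInvFunAux hv)).trans_lt
    ((hC.hausdorffMeasure_image_le m.cast_nonneg).trans_lt ?_)
  refine ENNReal.mul_lt_top (ENNReal.rpow_lt_top_of_nonneg m.cast_nonneg ENNReal.coe_ne_top) ?_
  rw [← hfr]
  exact hK.measure_lt_top

/-- Spheres in a Euclidean space of dimension `m + 1` have finite `m`-dimensional Hausdorff
measure. -/
lemma hausdorffMeasure_sphere_lt_top {m : ℕ} (hE : finrank ℝ E = m + 1) (r : ℝ) :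
    μH[(m : ℝ)] (sphere (0 : E) r) < ∞ := by
  have : Nontrivial E := nontrivial_of_finrank_pos (R := ℝ) (by omega)
  obtain ⟨v, hv⟩ := exists_norm_eq E zero_le_one
  have hunit : μH[(m : ℝ)] (sphere (0 : E) 1) < ∞ := by
    refine (measure_mono (t := {x : E | ‖x‖ = 1 ∧ inner ℝ v x ≤ 0} ∪
      {x : E | ‖x‖ = 1 ∧ inner ℝ (-v) x ≤ 0}) ?_).trans_lt (measure_union_lt_top
      (hausdorffMeasure_hemisphere_lt_top hE hv)
      (hausdorffMeasure_hemisphere_lt_top hE (by rwa [norm_neg])))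
    intro x hx
    rw [mem_sphere_zero_iff_norm] at hx
    rcases le_total (inner ℝ v x) 0 with h | h
    · exact Or.inl ⟨hx, h⟩
    · exact Or.inr ⟨hx, by rw [inner_neg_left]; linarith⟩
  have hsub : sphere (0 : E) r ⊆ (fun x : E ↦ r • x) '' sphere (0 : E) 1 := by
    intro x hx
    rw [mem_sphere_zero_iff_norm] at hx
    rcases eq_or_ne r 0 with rfl | hr
    · exact ⟨v, by simpa using hv, by simpa using (norm_eq_zero.mp hx).symm⟩
    · refine ⟨r⁻¹ • x, ?_, smul_inv_smul₀ hr x⟩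
      have hr0 : 0 ≤ r := hx ▸ norm_nonneg x
      rw [mem_sphere_zero_iff_norm, norm_smul, hx, norm_inv, Real.norm_of_nonneg hr0,
        inv_mul_cancel₀ hr]
  refine (measure_mono hsub).trans_lt
    (((lipschitzWith_smul r).hausdorffMeasure_image_le m.cast_nonneg _).trans_lt ?_)
  exact ENNReal.mul_lt_top (ENNReal.rpow_lt_top_of_nonneg m.cast_nonneg ENNReal.coe_ne_top) hunit

end HausdorffSphere

lemma integrableOn_of_continuousOn_of_measure_lt_top {E : Type*} [NormedAddCommGroup E]
    [MeasurableSpace E] [BorelSpace E] {K : Set E} {μ : Measure E}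
    (hK : IsCompact K) (hμ : μ K < ∞) {f : E → ℝ} (hf : ContinuousOn f K) :
    IntegrableOn f K μ := by
  have : IsFiniteMeasure (μ.restrict K) := ⟨by simpa using hμ⟩
  have h := hf.integrableOn_compact' (μ := μ.restrict K) hK hK.measurableSet
  rwa [IntegrableOn, Measure.restrict_restrict hK.measurableSet, Set.inter_self] at h

section PlaneRotation

variable {E : Type*} [NormedAddCommGroup E] [InnerProductSpace ℝ E]

open Metric

/-- The infinitesimal generator `x ↦ ⟪u, x⟫ v - ⟪v, x⟫ u` of the rotations in the plane spanned by
an orthonormal pair `u, v`. -/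
noncomputable def planeRotationField (u v : E) : E →L[ℝ] E :=
  (innerSL ℝ u).smulRight v - (innerSL ℝ v).smulRight u

lemma planeRotationField_apply (u v x : E) :
    planeRotationField u v x = inner ℝ u x • v - inner ℝ v x • u := by
  simp [planeRotationField]

/-- Rotation by the angle `θ` in the plane spanned by an orthonormal pair `u, v`. -/
noncomputable def planeRotation (u v : E) (θ : ℝ) : E →ₗ[ℝ] E :=
  LinearMap.id + (Real.cos θ - 1) •
      (((innerSL ℝ u).smulRight u + (innerSL ℝ v).smulRight v : E →L[ℝ] E) : E →ₗ[ℝ] E) +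
    Real.sin θ • (planeRotationField u v : E →ₗ[ℝ] E)

lemma planeRotation_apply (u v : E) (θ : ℝ) (x : E) :
    planeRotation u v θ x = x + (Real.cos θ - 1) • (inner ℝ u x • u + inner ℝ v x • v) +
      Real.sin θ • (inner ℝ u x • v - inner ℝ v x • u) := by
  simp [planeRotation, planeRotationField]

@[simp]
lemma planeRotation_zero (u v x : E) : planeRotation u v 0 x = x := by
  simp [planeRotation_apply]

variable {u v : E}

lemma inner_planeRotation_left (hu : ‖u‖ = 1) (huv : inner ℝ u v = 0) (θ : ℝ) (x : E) :
    inner ℝ u (planeRotation u v θ x) =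
      Real.cos θ * inner ℝ u x - Real.sin θ * inner ℝ v x := by
  have huu : inner ℝ u u = 1 := by rw [real_inner_self_eq_norm_sq, hu, one_pow]
  simp only [planeRotation_apply, inner_add_right, inner_sub_right, inner_smul_right, huu, huv]
  ring

lemma inner_planeRotation_right (hv : ‖v‖ = 1) (huv : inner ℝ u v = 0) (θ : ℝ) (x : E) :
    inner ℝ v (planeRotation u v θ x) =
      Real.sin θ * inner ℝ u x + Real.cos θ * inner ℝ v x := by
  have hvv : inner ℝ v v = 1 := by rw [real_inner_self_eq_norm_sq, hv, one_pow]
  have hvu : inner ℝ v u = 0 := by rw [real_inner_comm, huv]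
  simp only [planeRotation_apply, inner_add_right, inner_sub_right, inner_smul_right, hvv, hvu]
  ring

lemma norm_planeRotation (hu : ‖u‖ = 1) (hv : ‖v‖ = 1) (huv : inner ℝ u v = 0) (θ : ℝ) (x : E) :
    ‖planeRotation u v θ x‖ = ‖x‖ := by
  rw [← sq_eq_sq₀ (norm_nonneg _) (norm_nonneg _), ← real_inner_self_eq_norm_sq,
    ← real_inner_self_eq_norm_sq]
  conv_lhs => arg 2; rw [planeRotation_apply]
  simp only [inner_add_left, inner_sub_left, inner_smul_left, RCLike.conj_to_real,
    inner_planeRotation_left hu huv, inner_planeRotation_right hv huv]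
  simp only [planeRotation_apply, inner_add_right, inner_sub_right, inner_smul_right,
    real_inner_comm u x, real_inner_comm v x]
  linear_combination (inner ℝ u x ^ 2 + inner ℝ v x ^ 2) * Real.sin_sq_add_cos_sq θ

lemma hasDerivAt_planeRotation (hu : ‖u‖ = 1) (hv : ‖v‖ = 1) (huv : inner ℝ u v = 0)
    (x : E) (θ : ℝ) :
    HasDerivAt (fun t ↦ planeRotation u v t x)
      (planeRotationField u v (planeRotation u v θ x)) θ := by
  have h := ((((Real.hasDerivAt_cos θ).sub_const 1).smul_const
    (inner ℝ u x • u + inner ℝ v x • v)).const_add x).add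
    ((Real.hasDerivAt_sin θ).smul_const (inner ℝ u x • v - inner ℝ v x • u))
  simp only [planeRotation_apply u v _ x]
  refine h.congr_deriv ?_
  rw [← planeRotation_apply, planeRotationField_apply, inner_planeRotation_left hu huv,
    inner_planeRotation_right hv huv]
  module

variable [MeasurableSpace E] [BorelSpace E]

lemma setIntegral_sphere_comp_planeRotation [FiniteDimensional ℝ E] (hu : ‖u‖ = 1) (hv : ‖v‖ = 1)
    (huv : inner ℝ u v = 0) (d r θ : ℝ) (f : E → ℝ) :
    ∫ x in sphere (0 : E) r, f (planeRotation u v θ x) ∂μH[d] =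
      ∫ x in sphere (0 : E) r, f x ∂μH[d] := by
  let R : E ≃ₗᵢ[ℝ] E := LinearIsometry.toLinearIsometryEquiv
    ⟨planeRotation u v θ, norm_planeRotation hu hv huv θ⟩ rfl
  have hpre : R ⁻¹' sphere (0 : E) r = sphere (0 : E) r := by
    ext x
    simp
  have h := (R.toIsometryEquiv.measurePreserving_hausdorffMeasure d).setIntegral_preimage_emb
    R.toHomeomorph.measurableEmbedding f (sphere 0 r)
  exact (congrArg (fun s ↦ ∫ x in s, f (R x) ∂μH[d]) hpre).symm.trans h

/-- The derivative of a `C¹` function along an infinitesimal rotation integrates to zero over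
every sphere of finite Hausdorff measure. -/
lemma setIntegral_sphere_fderiv_planeRotationField [FiniteDimensional ℝ E] (hu : ‖u‖ = 1)
    (hv : ‖v‖ = 1) (huv : inner ℝ u v = 0) {d r : ℝ} (hμ : μH[d] (sphere (0 : E) r) < ∞)
    {f : E → ℝ} (hf : ∀ x ∈ sphere (0 : E) r, ContDiffAt ℝ 1 f x) :
    ∫ x in sphere (0 : E) r, fderiv ℝ f x (planeRotationField u v x) ∂μH[d] = 0 := by
  have hS : IsCompact (sphere (0 : E) r) := isCompact_sphere 0 r
  have hfin : IsFiniteMeasure (μH[d].restrict (sphere (0 : E) r)) := ⟨by simpa using hμ⟩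
  have hrot : ∀ θ, ∀ x ∈ sphere (0 : E) r, planeRotation u v θ x ∈ sphere (0 : E) r := by
    intro θ x hx
    rw [mem_sphere_zero_iff_norm] at hx ⊢
    rw [norm_planeRotation hu hv huv, hx]
  have hfc : ContinuousOn f (sphere (0 : E) r) :=
    fun x hx ↦ (hf x hx).continuousAt.continuousWithinAt
  have hgc : ContinuousOn (fun x ↦ fderiv ℝ f x (planeRotationField u v x))
      (sphere (0 : E) r) := fun x hx ↦
    (((hf x hx).fderiv_right (m := 0) (by norm_num)).continuousAt.clm_apply
      (planeRotationField u v).continuous.continuousAt).continuousWithinAt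
  obtain ⟨C, hC⟩ := hS.exists_bound_of_continuousOn hgc
  have hae : ∀ᵐ x ∂(μH[d].restrict (sphere (0 : E) r)), x ∈ sphere (0 : E) r :=
    ae_restrict_mem hS.measurableSet
  have hderiv := (hasDerivAt_integral_of_dominated_loc_of_deriv_le
    (μ := μH[d].restrict (sphere (0 : E) r)) (s := Set.univ) (x₀ := (0 : ℝ))
    (F := fun θ x ↦ f (planeRotation u v θ x))
    (F' := fun θ x ↦ fderiv ℝ f (planeRotation u v θ x)
      (planeRotationField u v (planeRotation u v θ x)))
    (bound := fun _ ↦ C) Filter.univ_mem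
    (Filter.Eventually.of_forall fun θ ↦ (hfc.comp
      (planeRotation u v θ).continuous_of_finiteDimensional.continuousOn
      (hrot θ)).aestronglyMeasurable hS.measurableSet)
    (by simpa [IntegrableOn] using integrableOn_of_continuousOn_of_measure_lt_top hS hμ hfc)
    (by simpa using hgc.aestronglyMeasurable hS.measurableSet)
    (hae.mono fun x hx θ _ ↦ hC _ (hrot θ x hx))
    (integrable_const C)
    (hae.mono fun x hx θ _ ↦ ((hf _ (hrot θ x hx)).differentiableAt
      one_ne_zero).hasFDerivAt.comp_hasDerivAt θ (hasDerivAt_planeRotation hu hv huv x θ))).2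
  simp only [setIntegral_sphere_comp_planeRotation hu hv huv, planeRotation_zero] at hderiv
  exact hderiv.unique (hasDerivAt_const _ _)

end PlaneRotation

/-- Lemma A.2 of the paper: for a `C¹` 2-tensor `T` on the exterior region
`{x : |x| ≥ 1}` of `ℝⁿ`, the sphere flux of its divergence is unchanged when the two
indices are transposed:
`∫_{S_r} T_{ij,j} ν_i = ∫_{S_r} T_{ji,j} ν_i`. -/
theorem stmt3 {n : ℕ} (hn : 2 ≤ n)
    (T : Fin n → Fin n → EuclideanSpace ℝ (Fin n) → ℝ)
    (hT : ∀ i j, ContDiffOn ℝ 1 (T i j) {x : EuclideanSpace ℝ (Fin n) | 1 ≤ ‖x‖})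
    (r : ℝ) (hr : 1 < r) :
    ∫ x in Metric.sphere (0 : EuclideanSpace ℝ (Fin n)) r,
        (∑ i : Fin n, ∑ j : Fin n,
          fderiv ℝ (T i j) x (EuclideanSpace.single j 1) * (x i / r))
      ∂(μH[(n : ℝ) - 1])
    = ∫ x in Metric.sphere (0 : EuclideanSpace ℝ (Fin n)) r,
        (∑ i : Fin n, ∑ j : Fin n,
          fderiv ℝ (T j i) x (EuclideanSpace.single j 1) * (x i / r))
      ∂(μH[(n : ℝ) - 1]) := by
  have hμ : μH[(n : ℝ) - 1] (Metric.sphere (0 : EuclideanSpace ℝ (Fin n)) r) < ∞ := by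
    obtain ⟨m, rfl⟩ : ∃ m, n = m + 1 := ⟨n - 1, by omega⟩
    simpa using hausdorffMeasure_sphere_lt_top (E := EuclideanSpace ℝ (Fin (m + 1))) (by simp) r
  have hS : IsCompact (Metric.sphere (0 : EuclideanSpace ℝ (Fin n)) r) := isCompact_sphere 0 r
  have hC : ∀ i j, ∀ x ∈ Metric.sphere (0 : EuclideanSpace ℝ (Fin n)) r,
      ContDiffAt ℝ 1 (T i j) x := by
    intro i j x hx
    refine (hT i j).contDiffAt (Filter.mem_of_superset
      ((isOpen_lt continuous_const continuous_norm).mem_nhds (?_ : 1 < ‖x‖)) fun y (hy : 1 < ‖y‖) ↦ hy.le)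
    rwa [mem_sphere_zero_iff_norm.mp hx]
  have hcont : ∀ i j k l, ContinuousOn
      (fun x ↦ fderiv ℝ (T i j) x (EuclideanSpace.single k 1) * (x l / r))
      (Metric.sphere (0 : EuclideanSpace ℝ (Fin n)) r) := by
    intro i j k l x hx
    have hl : Continuous fun x : EuclideanSpace ℝ (Fin n) ↦ x l / r := by fun_prop
    exact ((((hC i j x hx).fderiv_right (m := 0) (by norm_num)).continuousAt.clm_apply
      continuousAt_const).mul hl.continuousAt).continuousWithinAt
  have hrot : ∀ i j, ∫ x in Metric.sphere (0 : EuclideanSpace ℝ (Fin n)) r,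
      (fderiv ℝ (T i j) x (EuclideanSpace.single j 1) * (x i / r) -
        fderiv ℝ (T i j) x (EuclideanSpace.single i 1) * (x j / r)) ∂(μH[(n : ℝ) - 1]) = 0 := by
    intro i j
    rcases eq_or_ne i j with rfl | hij
    · simp
    have h := setIntegral_sphere_fderiv_planeRotationField
      (u := EuclideanSpace.single i (1 : ℝ)) (v := EuclideanSpace.single j (1 : ℝ))
      (by simp) (by simp) (by rw [EuclideanSpace.inner_single_left]; simp [hij]) hμ (hC i j)
    refine Eq.trans ?_ ((integral_const_mul r⁻¹ _).trans ((congrArg (r⁻¹ * ·) h).trans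
      (mul_zero _)))
    refine integral_congr_ae (.of_forall fun x ↦ ?_)
    simp only [planeRotationField_apply, EuclideanSpace.inner_single_left, map_sub, map_smul,
      map_one, one_mul, smul_eq_mul]
    ring
  have hint : ∀ i j k l, Integrable
      (fun x ↦ fderiv ℝ (T i j) x (EuclideanSpace.single k 1) * (x l / r))
      ((μH[(n : ℝ) - 1]).restrict (Metric.sphere (0 : EuclideanSpace ℝ (Fin n)) r)) :=
    fun i j k l ↦ integrableOn_of_continuousOn_of_measure_lt_top hS hμ (hcont i j k l)
  rw [← sub_eq_zero, ← integral_sub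
    (integrable_finsetSum _ fun i _ ↦ integrable_finsetSum _ fun j _ ↦ hint i j j i)
    (integrable_finsetSum _ fun i _ ↦ integrable_finsetSum _ fun j _ ↦ hint j i j i)]
  have hsum : ∀ x : EuclideanSpace ℝ (Fin n),
      (∑ i, ∑ j, fderiv ℝ (T i j) x (EuclideanSpace.single j 1) * (x i / r)) -
        ∑ i, ∑ j, fderiv ℝ (T j i) x (EuclideanSpace.single j 1) * (x i / r) =
      ∑ i, ∑ j, (fderiv ℝ (T i j) x (EuclideanSpace.single j 1) * (x i / r) -
        fderiv ℝ (T i j) x (EuclideanSpace.single i 1) * (x j / r)) := by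
    intro x
    simp only [Finset.sum_sub_distrib]
    congr 1
    exact Finset.sum_comm
  simp only [hsum]
  have hdiff : ∀ i j, Integrable
      (fun x ↦ fderiv ℝ (T i j) x (EuclideanSpace.single j 1) * (x i / r) -
        fderiv ℝ (T i j) x (EuclideanSpace.single i 1) * (x j / r))
      ((μH[(n : ℝ) - 1]).restrict (Metric.sphere (0 : EuclideanSpace ℝ (Fin n)) r)) :=
    fun i j ↦ (hint i j j i).sub (hint i j i j)
  rw [integral_finsetSum _ fun i _ ↦ integrable_finsetSum _ fun j _ ↦ hdiff i j]
  refine Finset.sum_eq_zero fun i _ ↦ ?_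
  rw [integral_finsetSum _ fun j _ ↦ hdiff i j]
  exact Finset.sum_eq_zero fun j _ ↦ hrot i j
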